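/- Let φ be a quantifier-free sentence of the extended variadic language L_Bor and let f : ℕ → ℕ be such that M_f ⊨ φ. Then there exists k ∈ ℕ such that for every g : ℕ → ℕ with g(i) = f(i) for all i ≤ k, we have M_g ⊨ φ. Consequently, for every quantifier-free sentence φ of L_Bor, the set {f ∈ ℕ^ℕ : M_f ⊨ φ} is clopen in the Baire space ℕ^ℕ (with the product topology, ℕ discrete). -/

import Mathlib

/-- The index data of the symbols `ℓ_ι`, `τ_ι` of `L_Bor`: a function
`ι : ℕⁿ → ℕ^{<ℕ} ∖ {⟨⟩}` (with `n > 0`). -/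
def BIota (n : ℕ) : Type := (Fin n → ℕ) → {l : List ℕ // l ≠ []}

/-- Terms of the extended variadic language `L_Bor`: numeral constant symbols `𝐧`,
variables (indexed by `ℕ`), the unary function symbol `𝐟`, the `n`-ary function symbols
`ℓ_ι`, and the `n`-ary-by-variadic function symbols `τ_ι`, the latter forming terms
`τ_ι(u₁,…,uₙ,u(𝟎)⋯ₓu(v))`. -/
inductive BTerm : Type
  | const : ℕ → BTerm
  | var : ℕ → BTerm
  | fapp : BTerm → BTerm
  | len : {n : ℕ} → BIota (n + 1) → (Fin (n + 1) → BTerm) → BTerm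
  | tau : {n : ℕ} → BIota (n + 1) → (Fin (n + 1) → BTerm) → BTerm → ℕ → BTerm → BTerm

namespace BTerm

/-- The free variables of an `L_Bor` term. -/
def fv : BTerm → Set ℕ
  | const _ => ∅
  | var x => {x}
  | fapp u => u.fv
  | len _ ts => ⋃ i, (ts i).fv
  | tau _ ts u x v => (⋃ i, (ts i).fv) ∪ (u.fv \ {x}) ∪ v.fv

/-- Substitution of a term for a variable in an `L_Bor` term. -/
def subst : BTerm → ℕ → BTerm → BTerm
  | const c, _, _ => const c
  | var y, x, t => if y = x then t else var y
  | fapp u, x, t => fapp (u.subst x t)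
  | len ι ts, x, t => len ι fun i => (ts i).subst x t
  | tau ι ts u y v, x, t =>
      if y = x then tau ι (fun i => (ts i).subst x t) u y (v.subst x t)
      else tau ι (fun i => (ts i).subst x t) (u.subst x t) y (v.subst x t)

/-- The depth of an `L_Bor` term. -/
def depth : BTerm → ℕ
  | const _ => 0
  | var _ => 0
  | fapp u => u.depth + 1
  | len _ ts => (Finset.univ.sup fun i => (ts i).depth) + 1
  | tau _ ts u _ v =>
      max ((Finset.univ.sup fun i => (ts i).depth)) (max u.depth v.depth) + 1

lemma depth_subst_const (x : ℕ) (c : ℕ) :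
    ∀ u : BTerm, (u.subst x (const c)).depth = u.depth
  | const _ => rfl
  | var y => by by_cases h : y = x <;> simp [subst, h, depth]
  | fapp u => by simp [subst, depth, depth_subst_const x c u]
  | len ι ts => by
      simp only [subst, depth]
      congr 1
      exact Finset.sup_congr rfl fun i _ => depth_subst_const x c (ts i)
  | tau ι ts u y v => by
      by_cases h : y = x <;>
        simp only [subst, h, depth, if_true, if_false, depth_subst_const x c u,
          depth_subst_const x c v] <;>
      · congr 2
        exact Finset.sup_congr rfl fun i _ => depth_subst_const x c (ts i)

/-- The interpretation of an `L_Bor` term in the structure `M_f`, by an assignment `s`,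
by recursion on term depth. -/
def interp (f : ℕ → ℕ) : BTerm → (ℕ → ℕ) → ℕ
  | const c, _ => c
  | var x, s => s x
  | fapp u, s => f (u.interp f s)
  | len ι ts, s => (ι fun i => (ts i).interp f s).1.length - 1
  | tau ι ts u x v, s =>
      if ((List.range (v.interp f s + 1)).map fun k => (u.subst x (const k)).interp f s) =
          (ι fun i => (ts i).interp f s).1 then 1 else 0
termination_by t _ => t.depth
decreasing_by
  all_goals first
    | exact Nat.lt_succ_of_le (Nat.le_refl _)
    | exact Nat.lt_succ_of_le (Finset.le_sup (f := fun i => (ts i).depth) (Finset.mem_univ i))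
    | exact Nat.lt_succ_of_le (le_trans (Finset.le_sup (f := fun i => (ts i).depth)
        (Finset.mem_univ i)) (le_max_left _ _))
    | exact Nat.lt_succ_of_le (le_trans (le_max_right _ _) (le_max_right _ _))
    | (rw [BTerm.depth_subst_const];
       exact Nat.lt_succ_of_le (le_trans (le_max_left _ _) (le_max_right _ _)))

end BTerm

/-- Formulas of `L_Bor`. -/
inductive BFormula : Type
  | eq : BTerm → BTerm → BFormula
  | not : BFormula → BFormula
  | and : BFormula → BFormula → BFormula
  | or : BFormula → BFormula → BFormula
  | imp : BFormula → BFormula → BFormula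
  | iff : BFormula → BFormula → BFormula
  | all : ℕ → BFormula → BFormula
  | ex : ℕ → BFormula → BFormula

namespace BFormula

/-- The free variables of an `L_Bor` formula. -/
def fv : BFormula → Set ℕ
  | eq u v => u.fv ∪ v.fv
  | not φ => φ.fv
  | and φ ψ => φ.fv ∪ ψ.fv
  | or φ ψ => φ.fv ∪ ψ.fv
  | imp φ ψ => φ.fv ∪ ψ.fv
  | iff φ ψ => φ.fv ∪ ψ.fv
  | all y φ => φ.fv \ {y}
  | ex y φ => φ.fv \ {y}

/-- Quantifier-free `L_Bor` formulas. -/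
inductive QF : BFormula → Prop
  | eq (u v : BTerm) : QF (.eq u v)
  | not {φ} : QF φ → QF (.not φ)
  | and {φ ψ} : QF φ → QF ψ → QF (.and φ ψ)
  | or {φ ψ} : QF φ → QF ψ → QF (.or φ ψ)
  | imp {φ ψ} : QF φ → QF ψ → QF (.imp φ ψ)
  | iff {φ ψ} : QF φ → QF ψ → QF (.iff φ ψ)

end BFormula

/-- Satisfaction `M_f ⊨ φ[s]` of an `L_Bor` formula by an assignment. -/
def BSatisfies (f : ℕ → ℕ) (s : ℕ → ℕ) : BFormula → Prop
  | .eq u v => u.interp f s = v.interp f s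
  | .not φ => ¬ BSatisfies f s φ
  | .and φ ψ => BSatisfies f s φ ∧ BSatisfies f s ψ
  | .or φ ψ => BSatisfies f s φ ∨ BSatisfies f s ψ
  | .imp φ ψ => BSatisfies f s φ → BSatisfies f s ψ
  | .iff φ ψ => (BSatisfies f s φ ↔ BSatisfies f s ψ)
  | .all x φ => ∀ n : ℕ, BSatisfies f (Function.update s x n) φ
  | .ex x φ => ∃ n : ℕ, BSatisfies f (Function.update s x n) φ

/-- `M_f ⊨ φ`: satisfaction by every assignment. -/
def BModels (f : ℕ → ℕ) (φ : BFormula) : Prop := ∀ s : ℕ → ℕ, BSatisfies f s φ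

mutual
/-- `Σₙ` prenex formulas of `L_Bor`: `n` alternating blocks of quantifiers beginning
with existentials, followed by a quantifier-free formula (blocks may be empty). -/
inductive SigmaFml : ℕ → BFormula → Prop
  | ofQF {φ} : BFormula.QF φ → SigmaFml 0 φ
  | ofPi {n φ} : PiFml n φ → SigmaFml (n + 1) φ
  | ex {n} (x : ℕ) {φ} : SigmaFml (n + 1) φ → SigmaFml (n + 1) (.ex x φ)

/-- `Πₙ` prenex formulas of `L_Bor`: `n` alternating blocks of quantifiers beginning
with universals, followed by a quantifier-free formula (blocks may be empty). -/
inductive PiFml : ℕ → BFormula → Prop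
  | ofQF {φ} : BFormula.QF φ → PiFml 0 φ
  | ofSigma {n φ} : SigmaFml n φ → PiFml (n + 1) φ
  | all {n} (x : ℕ) {φ} : PiFml (n + 1) φ → PiFml (n + 1) (.all x φ)
end

/-- The finite Borel hierarchy on Baire space: `Σ⁰₁` sets are the open sets, and
`Σ⁰ₙ₊₁` sets are countable unions of `Π⁰ₙ` sets, where a set is `Π⁰ₙ` iff its
complement is `Σ⁰ₙ`. -/
def SigmaPt : ℕ → Set (ℕ → ℕ) → Prop
  | 0, _ => False
  | 1, S => IsOpen S
  | (n + 2), S =>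
      ∃ A : ℕ → Set (ℕ → ℕ), (∀ i, SigmaPt (n + 1) (A i)ᶜ) ∧ S = ⋃ i, A i

/-- A set is `Π⁰ₙ` iff its complement is `Σ⁰ₙ`. -/
def PiPt (n : ℕ) (S : Set (ℕ → ℕ)) : Prop := SigmaPt n Sᶜ

open Filter Topology

namespace BTerm

/-- Substituting a constant for `x` removes `x` from the free variables. -/
lemma fv_subst_const (x c : ℕ) : ∀ u : BTerm, (u.subst x (const c)).fv = u.fv \ {x}
  | const _ => by simp [subst, fv]
  | var y => by
      by_cases h : y = x
      · simp [subst, fv, h]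
      · simpa [subst, fv, h] using (Set.sdiff_singleton_eq_self (s := {y}) (Ne.symm h)).symm
  | fapp u => by simp [subst, fv, fv_subst_const x c u]
  | len ι ts => by
      simp only [subst, fv, fun i => fv_subst_const x c (ts i), Set.iUnion_sdiff]
  | tau ι ts u y v => by
      by_cases h : y = x
      · subst h
        simp only [subst, if_true, fv, fun i => fv_subst_const y c (ts i),
          fv_subst_const y c v, Set.union_sdiff_distrib, Set.iUnion_sdiff, Set.sdiff_sdiff,
          Set.union_self]
      · simp only [subst, h, if_false, fv, fun i => fv_subst_const x c (ts i),
          fv_subst_const x c v, fv_subst_const x c u, Set.union_sdiff_distrib, Set.iUnion_sdiff,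
          Set.sdiff_sdiff, Set.union_comm {x} {y}]

/-- Induction on `L_Bor` terms in which the variadic argument of `τ_ι` is replaced by its
instances at constants. -/
lemma induction_subst_const {P : BTerm → Prop} (h_const : ∀ c, P (const c))
    (h_var : ∀ x, P (var x)) (h_fapp : ∀ u, P u → P (fapp u))
    (h_len : ∀ {n : ℕ} (ι : BIota (n + 1)) (ts : Fin (n + 1) → BTerm),
      (∀ i, P (ts i)) → P (len ι ts))
    (h_tau : ∀ {n : ℕ} (ι : BIota (n + 1)) (ts : Fin (n + 1) → BTerm) (u : BTerm) (x : ℕ)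
      (v : BTerm), (∀ i, P (ts i)) → (∀ c, P (u.subst x (const c))) → P v →
      P (tau ι ts u x v))
    (t : BTerm) : P t := by
  induction h : t.depth using Nat.strong_induction_on generalizing t with
  | _ d ih =>
    subst h
    have le_sup {n : ℕ} (ts : Fin (n + 1) → BTerm) (i : Fin (n + 1)) :
        (ts i).depth ≤ Finset.univ.sup fun i => (ts i).depth :=
      Finset.le_sup (f := fun i => (ts i).depth) (Finset.mem_univ i)
    cases t with
    | const c => exact h_const c
    | var x => exact h_var x
    | fapp u => exact h_fapp u (ih _ (by simp [depth]) u rfl)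
    | len ι ts =>
      exact h_len ι ts fun i => ih _ (by have := le_sup ts i; simp only [depth]; omega) _ rfl
    | tau ι ts u x v =>
      refine h_tau ι ts u x v (fun i => ih _ ?_ _ rfl) (fun c => ih _ ?_ _ rfl) (ih _ ?_ _ rfl)
      · have := le_sup ts i
        simp only [depth]
        omega
      · rw [depth_subst_const]
        simp only [depth]
        omega
      · simp only [depth]
        omega

/-- The interpretation of a term depends only on the values of its free variables. -/
lemma interp_congr (f : ℕ → ℕ) (t : BTerm) {s s' : ℕ → ℕ} (h : ∀ x ∈ t.fv, s x = s' x) :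
    t.interp f s = t.interp f s' := by
  induction t using induction_subst_const with
  | h_const c => simp [interp]
  | h_var x => simpa [interp, fv] using h
  | h_fapp u ih => simp only [interp, ih h]
  | h_len ι ts ih =>
    have hts i := ih i fun x hx => h x (Set.mem_iUnion_of_mem i hx)
    simp only [interp, hts]
  | h_tau ι ts u x v ihts ihu ihv =>
    have hts i := ihts i fun y hy => h y (.inl (.inl (Set.mem_iUnion_of_mem i hy)))
    have hu c := ihu c fun y hy => h y (.inl (.inr (fv_subst_const x c u ▸ hy)))
    have hv := ihv fun y hy => h y (.inr hy)
    simp only [interp, hts, hu, hv]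

/-- The interpretation of a term in `M_f` is locally constant in `f`. -/
lemma eventually_interp_eq (t : BTerm) (f s : ℕ → ℕ) :
    ∀ᶠ g in 𝓝 f, t.interp g s = t.interp f s := by
  induction t using induction_subst_const with
  | h_const c => simp [interp]
  | h_var x => simp [interp]
  | h_fapp u ih =>
    have hf : ∀ᶠ g : ℕ → ℕ in 𝓝 f, g (u.interp f s) = f (u.interp f s) :=
      (continuous_apply (u.interp f s)).continuousAt.eventually_mem
        ((isOpen_discrete {f (u.interp f s)}).mem_nhds rfl)
    filter_upwards [ih, hf] with g hu hg
    simp only [interp, hu, hg]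
  | h_len ι ts ih =>
    filter_upwards [eventually_all.2 ih] with g hg
    simp only [interp, hg]
  | h_tau ι ts u x v ihts ihu ihv =>
    have hu : ∀ᶠ g in 𝓝 f, ∀ c ∈ Finset.range (v.interp f s + 1),
        (u.subst x (const c)).interp g s = (u.subst x (const c)).interp f s :=
      (eventually_all_finset _).2 fun c _ => ihu c
    filter_upwards [eventually_all.2 ihts, hu, ihv] with g hts hu hv
    have hmap := List.map_congr_left (l := List.range (v.interp f s + 1))
      fun c hc => hu c (by simpa using hc)
    simp only [interp, hts, hv, hmap]

end BTerm

/-- Satisfaction of a quantifier-free formula depends only on the values of its free variables. -/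
lemma BFormula.QF.satisfies_congr {φ : BFormula} (hφ : φ.QF) (f : ℕ → ℕ) {s s' : ℕ → ℕ}
    (h : ∀ x ∈ φ.fv, s x = s' x) : BSatisfies f s φ ↔ BSatisfies f s' φ := by
  induction hφ with
  | eq u v =>
    simp only [BSatisfies, u.interp_congr f fun x hx => h x (.inl hx),
      v.interp_congr f fun x hx => h x (.inr hx)]
  | not _ ih => simp only [BSatisfies, ih h]
  | and _ _ ih₁ ih₂ | or _ _ ih₁ ih₂ | imp _ _ ih₁ ih₂ | iff _ _ ih₁ ih₂ =>
    simp only [BSatisfies, ih₁ fun x hx => h x (.inl hx), ih₂ fun x hx => h x (.inr hx)]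

/-- Satisfaction of a quantifier-free formula in `M_f` is locally constant in `f`. -/
lemma BFormula.QF.eventually_satisfies_iff {φ : BFormula} (hφ : φ.QF) (f s : ℕ → ℕ) :
    ∀ᶠ g in 𝓝 f, (BSatisfies g s φ ↔ BSatisfies f s φ) := by
  induction hφ with
  | eq u v =>
    filter_upwards [u.eventually_interp_eq f s, v.eventually_interp_eq f s] with g hu hv
    simp only [BSatisfies, hu, hv]
  | not _ ih =>
    filter_upwards [ih] with g h
    simp only [BSatisfies, h]
  | and _ _ ih₁ ih₂ | or _ _ ih₁ ih₂ | imp _ _ ih₁ ih₂ | iff _ _ ih₁ ih₂ =>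
    filter_upwards [ih₁, ih₂] with g h₁ h₂
    simp only [BSatisfies, h₁, h₂]

/-- A quantifier-free sentence holds in `M_f` iff it is satisfied by some fixed assignment. -/
lemma BFormula.QF.models_iff {φ : BFormula} (hφ : φ.QF) (h : φ.fv = ∅) (f s : ℕ → ℕ) :
    BModels f φ ↔ BSatisfies f s φ :=
  ⟨fun hf => hf s, fun hs s' => (hφ.satisfies_congr f (by simp [h])).1 hs⟩

/-- Truth of a quantifier-free sentence in `M_f` is locally constant in `f`. -/
lemma BFormula.QF.eventually_models_iff {φ : BFormula} (hφ : φ.QF) (h : φ.fv = ∅) (f : ℕ → ℕ) :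
    ∀ᶠ g in 𝓝 f, (BModels g φ ↔ BModels f φ) := by
  simpa only [hφ.models_iff h _ 0] using hφ.eventually_satisfies_iff f 0

/-- Every neighbourhood of `f` in Baire space contains all `g` agreeing with `f` up to some
`k`. -/
lemma exists_forall_le_eq_of_eventually_nhds {f : ℕ → ℕ} {p : (ℕ → ℕ) → Prop}
    (h : ∀ᶠ g in 𝓝 f, p g) : ∃ k : ℕ, ∀ g : ℕ → ℕ, (∀ i ≤ k, g i = f i) → p g := by
  rw [nhds_pi, Filter.Eventually, Filter.mem_pi'] at h
  obtain ⟨I, t, ht, hsub⟩ := h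
  refine ⟨I.sup id, fun g hg => hsub fun i hi => ?_⟩
  rw [hg i (Finset.le_sup (f := id) hi)]
  exact mem_of_mem_nhds (ht i)

/-- If `φ` is a quantifier-free sentence of `L_Bor` and `M_f ⊨ φ`, then there is `k` such
that `M_g ⊨ φ` for every `g` agreeing with `f` up to `k`; consequently, the set of `f`
with `M_f ⊨ φ` is clopen in Baire space. -/
theorem qf_sentence_clopen :
    (∀ φ : BFormula, BFormula.QF φ → φ.fv = ∅ → ∀ f : ℕ → ℕ, BModels f φ →
      ∃ k : ℕ, ∀ g : ℕ → ℕ, (∀ i ≤ k, g i = f i) → BModels g φ) ∧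
    (∀ φ : BFormula, BFormula.QF φ → φ.fv = ∅ →
      IsClopen {f : ℕ → ℕ | BModels f φ}) := by
  refine ⟨fun φ hφ h f hf => ?_, fun φ hφ h => ⟨⟨?_⟩, ?_⟩⟩
  · exact exists_forall_le_eq_of_eventually_nhds
      ((hφ.eventually_models_iff h f).mono fun g hg => hg.2 hf)
  · refine isOpen_iff_mem_nhds.2 fun f hf => ?_
    exact (hφ.eventually_models_iff h f).mono fun g hg => mt hg.1 hf
  · refine isOpen_iff_mem_nhds.2 fun f hf => ?_
    exact (hφ.eventually_models_iff h f).mono fun g hg => hg.2 hf
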